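/- arXiv:1808.05688 — 2 statements merged into one kernel-verified Lean document; each statement's English description precedes it below -/
import Mathlib

section
/- Let A be a nonempty finite set of positive integers with gcd(A) = 1. Then there exists k ∈ ℕ such that 1 ∈ A^k, where A^k denotes the k-th iterate of the Nash step applied to A. (Combinatorially, a finite iteration of Nash modification resolves the singularities of the toric curve defined by A.) -/
/-- One step of the combinatorial Nash modification algorithm on a finite set of
naturals: with `m = min A`, `nash A = {m} ∪ {a - m : a ∈ A, a > m}`. -/
def nash (A : Finset ℕ) : Finset ℕ :=
  if h : A.Nonempty then
    insert (A.min' h)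
      ((A.filter (fun a => A.min' h < a)).image (fun a => a - A.min' h))
  else ∅

lemma nash_nonempty {A : Finset ℕ} (h : A.Nonempty) : (nash A).Nonempty := by
  rw [nash, dif_pos h]; exact Finset.insert_nonempty _ _

lemma nash_eq {A : Finset ℕ} (h : A.Nonempty) : nash A = insert (A.min' h)
      ((A.filter (fun a => A.min' h < a)).image (fun a => a - A.min' h)) := by
  rw [nash, dif_pos h]

lemma nash_pos {A : Finset ℕ} (h : A.Nonempty) (hpos : ∀ a ∈ A, 0 < a) :
    ∀ a ∈ nash A, 0 < a := by
  intro a ha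
  rw [nash_eq h, Finset.mem_insert, Finset.mem_image] at ha
  rcases ha with rfl | ⟨b, hb, rfl⟩
  · exact hpos _ (A.min'_mem h)
  · have := (Finset.mem_filter.1 hb).2
    omega

lemma nash_gcd {A : Finset ℕ} (h : A.Nonempty) (hgcd : A.gcd id = 1) :
    (nash A).gcd id = 1 := by
  rw [← Nat.dvd_one, ← hgcd]
  apply Finset.dvd_gcd
  intro a ha
  have hd : ∀ b ∈ nash A, (nash A).gcd id ∣ b := fun b hb => Finset.gcd_dvd (f := id) hb
  have h1 : (nash A).gcd id ∣ A.min' h := hd _ (by rw [nash_eq h]; simp)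
  have hle := A.min'_le a ha
  rcases hle.eq_or_lt with he | hl
  · rw [id, ← he]; exact h1
  · have h2 : (nash A).gcd id ∣ a - A.min' h := hd _ (by
      rw [nash_eq h]
      exact Finset.mem_insert_of_mem
        (Finset.mem_image.2 ⟨a, Finset.mem_filter.2 ⟨ha, hl⟩, rfl⟩))
    have := Nat.dvd_add h2 h1
    rwa [Nat.sub_add_cancel hle] at this

lemma nash_sum_lt {A : Finset ℕ} (h : A.Nonempty) (hpos : ∀ a ∈ A, 0 < a)
    (hx : ∃ x ∈ A, A.min' h < x) : ∑ a ∈ nash A, a < ∑ a ∈ A, a := by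
  have hm := A.min'_mem h
  have hp := hpos _ hm
  have hle : ∀ a ∈ A, A.min' h ≤ a := fun a ha => A.min'_le a ha
  rw [nash_eq h]
  generalize A.min' h = m at *
  have hA : A = insert m (A.filter (fun a => m < a)) := by
    ext a
    simp only [Finset.mem_insert, Finset.mem_filter]
    constructor
    · intro ha
      rcases (hle a ha).eq_or_lt with h | h
      · exact Or.inl h.symm
      · exact Or.inr ⟨ha, h⟩
    · rintro (rfl | ⟨ha, -⟩) <;> assumption
  have e : ∑ a ∈ A, a = m + ∑ a ∈ A.filter (fun a => m < a), a := by
    conv_lhs => rw [hA]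
    rw [Finset.sum_insert (by simp)]
  rw [e]
  have h1 : ∑ a ∈ insert m ((A.filter (fun a => m < a)).image (fun a => a - m)), a
      ≤ m + ∑ a ∈ (A.filter (fun a => m < a)).image (fun a => a - m), a := by
    by_cases hc : m ∈ (A.filter (fun a => m < a)).image (fun a => a - m)
    · rw [Finset.insert_eq_of_mem hc]; omega
    · rw [Finset.sum_insert hc]
  have h2 : ∑ a ∈ (A.filter (fun a => m < a)).image (fun a => a - m), a
      = ∑ a ∈ A.filter (fun a => m < a), (a - m) := by
    apply Finset.sum_image
    intro a ha b hb hab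
    have := (Finset.mem_filter.1 ha).2
    have := (Finset.mem_filter.1 hb).2
    simp only at hab
    omega
  have h3 : ∑ a ∈ A.filter (fun a => m < a), (a - m) < ∑ a ∈ A.filter (fun a => m < a), a := by
    obtain ⟨x, hxA, hmx⟩ := hx
    apply Finset.sum_lt_sum_of_nonempty ⟨x, Finset.mem_filter.2 ⟨hxA, hmx⟩⟩
    intro a ha
    have := (Finset.mem_filter.1 ha).2
    omega
  omega

lemma nash_aux (n : ℕ) : ∀ A : Finset ℕ, A.Nonempty → (∀ a ∈ A, 0 < a) → A.gcd id = 1 →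
    ∑ a ∈ A, a = n → ∃ k : ℕ, 1 ∈ nash^[k] A := by
  induction n using Nat.strong_induction_on with
  | _ n ih =>
    intro A h hpos hgcd hn
    by_cases hx : ∃ x ∈ A, A.min' h < x
    · obtain ⟨k, hk⟩ := ih _ (hn ▸ nash_sum_lt h hpos hx) (nash A) (nash_nonempty h)
        (nash_pos h hpos) (nash_gcd h hgcd) rfl
      exact ⟨k + 1, by rwa [Function.iterate_succ_apply]⟩
    · push Not at hx
      refine ⟨0, ?_⟩
      have hm : A.min' h = 1 := by
        rw [← Nat.dvd_one, ← hgcd]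
        apply Finset.dvd_gcd
        intro a ha
        rw [id, le_antisymm (hx a ha) (A.min'_le a ha)]
      have := A.min'_mem h
      rw [hm] at this
      exact this

theorem nash_resolves (A : Finset ℕ) (hA : A.Nonempty)
    (hpos : ∀ a ∈ A, 0 < a) (hgcd : A.gcd id = 1) :
    ∃ k : ℕ, 1 ∈ nash^[k] A := by
  exact nash_aux _ A hA hpos hgcd rfl
end

section
/- Let A be a nonempty finite set of positive integers with gcd(A) = 1 and with 1 < a₁ := min A, and let a₂ := min(A \ {a₁}). Let m ∈ ℕ be such that a₁ < F(m+1) or a₂ < F(m+2), where F is the Fibonacci sequence with F(1) = 1, F(2) = 2, F(m+2) = F(m+1) + F(m). Then δ(A) < m. -/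
/-- `eta A` = least number of Nash steps after which `1` appears. -/
noncomputable def eta (A : Finset ℕ) : ℕ :=
  sInf { k : ℕ | 1 ∈ nash^[k] A }

/-- `delta A` = number of strict drops of the minimum along the Nash algorithm,
i.e. the number of division algorithms into which it decomposes. -/
noncomputable def delta (A : Finset ℕ) : ℕ :=
  ((Finset.Icc 1 (eta A)).filter
    (fun k => (nash^[k] A).min < (nash^[k - 1] A).min)).card

/-- Fibonacci sequence normalized by `F 1 = 1`, `F 2 = 2`,
`F (m+2) = F (m+1) + F m`. -/
def F (n : ℕ) : ℕ := Nat.fib (n + 1)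

/-- Number of strict drops of the minimum during the first `k` Nash steps. -/
def drops (k : ℕ) (A : Finset ℕ) : ℕ :=
  ∑ i ∈ Finset.range k, if (nash^[i + 1] A).min < (nash^[i] A).min then 1 else 0

lemma drops_succ (k : ℕ) (A : Finset ℕ) :
    drops (k + 1) A = drops k (nash A) + if (nash A).min < A.min then 1 else 0 := by
  unfold drops
  rw [Finset.sum_range_succ']
  rfl

lemma delta_eq_drops (A : Finset ℕ) : delta A = drops (eta A) A := by
  unfold delta drops
  rw [Finset.card_filter, Finset.range_eq_Ico, ← Finset.Ico_add_one_right_eq_Icc]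
  rw [Finset.sum_Ico_eq_sum_range, Finset.range_eq_Ico]
  refine Finset.sum_congr (by simp) fun i _ => ?_
  rw [Nat.add_comm 1 i, Nat.add_sub_cancel]

lemma mem_nash {A : Finset ℕ} (h : A.Nonempty) (x : ℕ) :
    x ∈ nash A ↔ x = A.min' h ∨ ∃ a ∈ A, A.min' h < a ∧ a - A.min' h = x := by
  simp [nash, dif_pos h, and_assoc]

lemma F_add_two (n : ℕ) : F (n + 2) = F n + F (n + 1) := by
  simp only [F]
  rw [show n + 2 + 1 = (n + 1) + 2 by ring, Nat.fib_add_two]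

lemma F_le (n : ℕ) : F n ≤ F (n + 1) := Nat.fib_mono (by omega)

lemma drops_bound (k : ℕ) : ∀ (A : Finset ℕ) (hA : A.Nonempty), (∀ a ∈ A, 0 < a) →
    F (drops k A + 1) ≤ A.min' hA ∧ ∀ x ∈ A, x ≠ A.min' hA → F (drops k A + 2) ≤ x := by
  induction k with
  | zero =>
    intro A hA hpos
    have h0 := hpos _ (A.min'_mem hA)
    refine ⟨by simp [drops, F]; exact hpos, fun x hx hne => ?_⟩
    have := A.min'_le x hx
    have h2 : F (drops 0 A + 2) = 2 := by simp [drops, F, Nat.fib_add_two]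
    omega
  | succ k ih =>
    intro A hA hpos
    have hN := nash_nonempty hA
    have hposN : ∀ a ∈ nash A, 0 < a := by
      intro a ha
      rcases (mem_nash hA a).1 ha with h | ⟨b, hb, hlt, h⟩
      · rw [h]; exact hpos _ (A.min'_mem hA)
      · omega
    obtain ⟨i1, i2⟩ := ih (nash A) hN hposN
    have hmem : A.min' hA ∈ nash A := (mem_nash hA _).2 (Or.inl rfl)
    have hle : (nash A).min' hN ≤ A.min' hA := Finset.min'_le _ _ hmem
    have hsub : ∀ x ∈ A, x ≠ A.min' hA → A.min' hA < x ∧ x - A.min' hA ∈ nash A := by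
      intro x hx hne
      have hlt : A.min' hA < x := lt_of_le_of_ne (A.min'_le x hx) (Ne.symm hne)
      exact ⟨hlt, (mem_nash hA _).2 (Or.inr ⟨x, hx, hlt, rfl⟩)⟩
    have hiff : (nash A).min < A.min ↔ (nash A).min' hN < A.min' hA := by
      rw [← Finset.coe_min' hN, ← Finset.coe_min' hA, WithTop.coe_lt_coe]
    rw [drops_succ]
    generalize drops k (nash A) = d at *
    have f1 := F_add_two d
    have f2 := F_add_two (d + 1)
    have f3 := F_le d
    by_cases hd : (nash A).min' hN < A.min' hA
    · rw [if_pos (hiff.2 hd)]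
      have j := i2 _ hmem (by omega)
      refine ⟨j, fun x hx hne => ?_⟩
      obtain ⟨hlt, hxm⟩ := hsub x hx hne
      have := Finset.min'_le _ _ hxm
      change F (d + 1 + 2) ≤ x
      change F (d + 1 + 2) = F (d + 1) + F (d + 2) at f2
      omega
    · rw [if_neg (fun h => hd (hiff.1 h))]
      have heq : (nash A).min' hN = A.min' hA := by omega
      refine ⟨by simpa [heq] using i1, fun x hx hne => ?_⟩
      obtain ⟨hlt, hxm⟩ := hsub x hx hne
      change F (d + 2) ≤ x
      by_cases hx2 : x - A.min' hA = (nash A).min' hN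
      · omega
      · have := i2 _ hxm hx2
        omega

theorem delta_lt_of_lt_fib (A : Finset ℕ) (hA : A.Nonempty)
    (hpos : ∀ a ∈ A, 0 < a) (hgcd : A.gcd id = 1)
    (a₁ : ℕ) (ha₁ : a₁ = A.min' hA) (h1 : 1 < a₁)
    (a₂ : ℕ) (ha₂ : a₂ = sInf { x : ℕ | x ∈ A ∧ x ≠ a₁ })
    (m : ℕ) (hm : a₁ < F (m + 1) ∨ a₂ < F (m + 2)) :
    delta A < m := by
  obtain ⟨b1, b2⟩ := drops_bound (eta A) A hA hpos
  rw [← delta_eq_drops, ← ha₁] at b1 b2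
  have hne : { x : ℕ | x ∈ A ∧ x ≠ a₁ }.Nonempty := by
    by_contra hemp
    have hall : ∀ x ∈ A, x = a₁ := by
      intro x hx
      by_contra hxa
      exact hemp ⟨x, hx, hxa⟩
    have hdvd : a₁ ∣ A.gcd id := Finset.dvd_gcd fun x hx => by simp [hall x hx]
    rw [hgcd, Nat.dvd_one] at hdvd
    omega
  have hmem := Nat.sInf_mem hne
  rw [← ha₂] at hmem
  have b3 := b2 a₂ hmem.1 hmem.2
  by_contra hlt
  have m1 : F (m + 1) ≤ F (delta A + 1) := Nat.fib_mono (by omega)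
  have m2 : F (m + 2) ≤ F (delta A + 2) := Nat.fib_mono (by omega)
  omega
end
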